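/- arXiv:1812.03349 — 3 statements merged into one kernel-verified Lean document; each statement's English description precedes it below -/
import Mathlib

section
/- Let ξ be a sequence in H with synthesis operator D_ξ : dom(D_ξ) ⊆ ℓ² → H, D_ξ{cₙ} = Σₙ cₙ ξₙ, defined on the set of {cₙ} ∈ ℓ² for which the series converges. Then the adjoint of D_ξ is the analysis operator C_ξ, i.e. D_ξ* = C_ξ. -/
local notation "⟪" x ", " y "⟫" => @inner ℂ _ _ x y

/-- `D_ξ* = C_ξ`: a pair `(f, h) ∈ H × ℓ²` satisfies `⟨D_ξ c, f⟩ = ⟨c, h⟩_{ℓ²}` for all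
`c ∈ dom(D_ξ)` (i.e. all `c ∈ ℓ²` such that `Σₙ cₙ ξₙ` converges) if and only if
`f ∈ dom(ξ)` and `h = C_ξ f = {⟨f,ξₙ⟩}`. -/
theorem stmt2 {H : Type*} [NormedAddCommGroup H] [InnerProductSpace ℂ H] [CompleteSpace H]
    (ξ : ℕ → H) (f : H) (h : lp (fun _ : ℕ => ℂ) 2) :
    (∀ (c : lp (fun _ : ℕ => ℂ) 2) (s : H),
        HasSum (fun n => c n • ξ n) s → ⟪s, f⟫ = ⟪c, h⟫)
    ↔ (Memℓp (fun n => ⟪ξ n, f⟫) 2 ∧ ∀ n, h n = ⟪ξ n, f⟫) := by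
  constructor
  · intro hyp
    have key : ∀ n, h n = ⟪ξ n, f⟫ := by
      intro n
      have h1 := hyp (lp.single 2 n (1 : ℂ)) (ξ n) (by
        have h2 := hasSum_single (f := fun m => (lp.single 2 n (1 : ℂ) : lp (fun _ : ℕ => ℂ) 2) m • ξ m) n
          (by
            intro m hm
            simp [lp.single_apply, hm])
        simpa using h2)
      rw [lp.inner_single_left] at h1
      simpa using h1.symm
    refine ⟨?_, key⟩
    have h3 := lp.memℓp h
    have h4 : (fun n => ⟪ξ n, f⟫) = (h : ∀ _ : ℕ, ℂ) := funext fun n => (key n).symm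
    rw [h4]
    exact h3
  · rintro ⟨-, key⟩ c s hs
    have h1 : HasSum (fun n => ⟪c n • ξ n, f⟫) ⟪s, f⟫ := by
      have h5 := (hs.mapL (innerSL ℂ f)).star
      simpa [inner_conj_symm, inner_smul_left, mul_comm] using h5
    have h2 := lp.hasSum_inner (𝕜 := ℂ) c h
    refine h1.unique ?_
    have h6 : (fun n => ⟪c n • ξ n, f⟫) = fun n => ⟪c n, h n⟫ := by
      funext n
      rw [key n, inner_smul_left]
      simp [mul_comm]
    rw [h6]
    exact h2
end

section
/- If ξ, η are sequences in H such that the sesquilinear form Ω_{ξ,η}(f,g) = Σₙ ⟨f,ξₙ⟩⟨ηₙ,g⟩ converges for all f,g ∈ H, then Ω_{ξ,η} is bounded: there is C > 0 with |Ω_{ξ,η}(f,g)| ≤ C‖f‖‖g‖ for all f,g ∈ H. -/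
local notation "⟪" x ", " y "⟫" => @inner ℂ _ _ x y

/-- The form is bounded already when the partial sums converge (possibly conditionally). -/
theorem bounded_of_tendsto {H : Type*} [NormedAddCommGroup H] [InnerProductSpace ℂ H]
    [CompleteSpace H] (ξ η : ℕ → H)
    (hconv : ∀ f g : H, ∃ L : ℂ, Filter.Tendsto
      (fun k => ∑ n ∈ Finset.range k, ⟪ξ n, f⟫ * ⟪g, η n⟫) Filter.atTop (nhds L)) :
    ∃ C > (0 : ℝ), ∀ (f g : H) (L : ℂ), Filter.Tendsto
      (fun k => ∑ n ∈ Finset.range k, ⟪ξ n, f⟫ * ⟪g, η n⟫) Filter.atTop (nhds L) →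
      ‖L‖ ≤ C * ‖f‖ * ‖g‖ := by
  let T : ℕ → H →L[ℂ] H := fun k =>
    ∑ n ∈ Finset.range k, (innerSL ℂ (ξ n)).smulRight (η n)
  have hT : ∀ k f g, ⟪g, T k f⟫ = ∑ n ∈ Finset.range k, ⟪ξ n, f⟫ * ⟪g, η n⟫ := by
    intro k f g
    simp [T, ContinuousLinearMap.sum_apply, inner_sum, inner_smul_right]
  have h1 : ∀ f, ∃ C, ∀ k, ‖T k f‖ ≤ C := by
    intro f
    obtain ⟨C, hC⟩ := banach_steinhaus (g := fun k => innerSL ℂ (T k f)) (by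
      intro g
      obtain ⟨L, hL⟩ := hconv f g
      obtain ⟨C, hC⟩ := (Metric.isBounded_range_of_tendsto _ hL).exists_norm_le
      refine ⟨C, fun k => ?_⟩
      rw [innerSL_apply_apply, norm_inner_symm, hT]
      exact hC _ ⟨k, rfl⟩)
    exact ⟨C, fun k => by simpa using hC k⟩
  obtain ⟨C, hC⟩ := banach_steinhaus h1
  refine ⟨max C 1, by positivity, fun f g L hL => ?_⟩
  refine le_of_tendsto hL.norm (Filter.Eventually.of_forall fun k => ?_)
  rw [← hT]
  calc ‖⟪g, T k f⟫‖ ≤ ‖g‖ * ‖T k f‖ := norm_inner_le_norm _ _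
    _ ≤ ‖g‖ * (max C 1 * ‖f‖) := by
      gcongr
      exact (T k).le_of_opNorm_le ((hC k).trans (le_max_left _ _)) f
    _ = max C 1 * ‖f‖ * ‖g‖ := by ring

/-- If `ξ, η` are sequences such that `Ω_{ξ,η}(f,g) = Σₙ ⟨f,ξₙ⟩⟨ηₙ,g⟩` converges for all
`f, g ∈ H`, then `Ω_{ξ,η}` is bounded: `|Ω_{ξ,η}(f,g)| ≤ C‖f‖‖g‖` for some `C > 0`. -/
theorem stmt10 {H : Type*} [NormedAddCommGroup H] [InnerProductSpace ℂ H] [CompleteSpace H]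
    (ξ η : ℕ → H)
    (hconv : ∀ f g : H, Summable fun n => ⟪ξ n, f⟫ * ⟪g, η n⟫) :
    ∃ C > (0 : ℝ), ∀ f g : H, ‖∑' n, ⟪ξ n, f⟫ * ⟪g, η n⟫‖ ≤ C * ‖f‖ * ‖g‖ := by
  obtain ⟨C, hC, h⟩ := bounded_of_tendsto ξ η
    (fun f g => ⟨_, (hconv f g).hasSum.tendsto_sum_nat⟩)
  exact ⟨C, hC, fun f g => h f g _ (hconv f g).hasSum.tendsto_sum_nat⟩
end

section
/- Let ξ, η be sequences in H with dom(η) dense, and suppose Ω_{ξ,η}(f,g) = ⟨C_ξ f, C_η g⟩_{ℓ²} on dom(ξ) × dom(η) is 0-closed, i.e., ξ and η are lower semi-frames and R(C_ξ) ∔ R(C_η)^⊥ = ℓ² (direct sum of closed subspaces). Then the operator C_η* C_ξ is boundedly invertible: 0 ∈ ρ(C_η* C_ξ). -/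
local notation "⟪" x ", " y "⟫" => @inner ℂ _ _ x y

lemma aux_norm_sq (c : lp (fun _ : ℕ => ℂ) 2) : 
    (Summable fun n => ‖c n‖ ^ 2) ∧ ‖c‖ ^ 2 = ∑' n, ‖c n‖ ^ 2 := by
  have h := lp.hasSum_norm (p := 2) (by norm_num) c
  have h2 : HasSum (fun n => ‖c n‖ ^ 2) (‖c‖ ^ 2) := by
    simpa using h
  exact ⟨h2.summable, h2.tsum_eq.symm⟩

lemma aux_mem {H : Type*} [NormedAddCommGroup H] [InnerProductSpace ℂ H]
    (ξ : ℕ → H) (f : H) (hf : Summable fun n => ‖⟪ξ n, f⟫‖ ^ 2) :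
    ∃ c : lp (fun _ : ℕ => ℂ) 2, ∀ n, c n = ⟪ξ n, f⟫ := by
  refine ⟨⟨fun n => ⟪ξ n, f⟫, ?_⟩, fun n => rfl⟩
  refine (memℓp_gen_iff (by norm_num)).2 ?_
  simpa using hf

/-- graph of the analysis operator -/
def auxGraph {H : Type*} [NormedAddCommGroup H] [InnerProductSpace ℂ H]
    (ξ : ℕ → H) : Submodule ℂ (H × lp (fun _ : ℕ => ℂ) 2) where
  carrier := {p | ∀ n, p.2 n = ⟪ξ n, p.1⟫}
  add_mem' := by
    intro a b ha hb n
    have h1 := ha n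
    have h2 := hb n
    simp only [Prod.fst_add, Prod.snd_add, inner_add_right, ← h1, ← h2]
    rfl
  zero_mem' := by
    intro n
    simp
  smul_mem' := by
    intro a b hb n
    have h1 := hb n
    simp only [Prod.smul_fst, Prod.smul_snd, inner_smul_right, ← h1]
    rfl

lemma auxGraph_closed {H : Type*} [NormedAddCommGroup H] [InnerProductSpace ℂ H]
    (ξ : ℕ → H) : IsClosed (auxGraph ξ : Set (H × lp (fun _ : ℕ => ℂ) 2)) := by
  have : (auxGraph ξ : Set (H × lp (fun _ : ℕ => ℂ) 2)) =
      ⋂ n, {p | p.2 n = ⟪ξ n, p.1⟫} := by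
    ext p
    rw [Set.mem_iInter]
    rfl
  rw [this]
  refine isClosed_iInter fun n => isClosed_eq ?_ (by fun_prop)
  exact ((lp.evalCLM ℂ (fun _ : ℕ => ℂ) 2 n).continuous).comp continuous_snd

lemma aux_main {H : Type*} [NormedAddCommGroup H] [InnerProductSpace ℂ H] [CompleteSpace H]
    (ξ : ℕ → H)
    (hξlow : ∃ A > (0 : ℝ), ∀ f : H, (Summable fun n => ‖⟪ξ n, f⟫‖ ^ 2) →
      A * ‖f‖ ^ 2 ≤ ∑' n, ‖⟪ξ n, f⟫‖ ^ 2) :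
    ∃ (R : Submodule ℂ (lp (fun _ : ℕ => ℂ) 2)) (K : R →L[ℂ] H),
      IsClosed (R : Set (lp (fun _ : ℕ => ℂ) 2)) ∧
      (∀ c : R, ∀ n, (c : lp (fun _ : ℕ => ℂ) 2) n = ⟪ξ n, K c⟫) ∧
      ∀ (f : H) (c : lp (fun _ : ℕ => ℂ) 2), (∀ n, c n = ⟪ξ n, f⟫) →
        ∃ hc : c ∈ R, K ⟨c, hc⟩ = f := by
  obtain ⟨A, hA, hlow⟩ := hξlow
  have : CompleteSpace (auxGraph ξ) := (auxGraph_closed ξ).completeSpace_coe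
  let F : auxGraph ξ →L[ℂ] lp (fun _ : ℕ => ℂ) 2 :=
    (ContinuousLinearMap.snd ℂ H (lp (fun _ : ℕ => ℂ) 2)).comp (auxGraph ξ).subtypeL
  have hF : ∀ p : auxGraph ξ, F p = p.1.2 := fun p => rfl
  have hb : ∀ p : auxGraph ξ, ‖p‖ ≤ (max 1 (1 / √A)).toNNReal * ‖F p‖ := by
    rintro ⟨⟨f, c⟩, hp⟩
    have hp' : ∀ n, c n = ⟪ξ n, f⟫ := hp
    obtain ⟨h1, h2⟩ := aux_norm_sq c
    simp only [hp'] at h1 h2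
    have h3 := hlow f h1
    rw [← h2] at h3
    have h4 : √A * ‖f‖ ≤ ‖c‖ := by
      refine (sq_le_sq₀ (by positivity) (norm_nonneg _)).1 ?_
      rw [mul_pow, Real.sq_sqrt hA.le]
      exact h3
    rw [Real.coe_toNNReal _ (by positivity)]
    change max ‖f‖ ‖c‖ ≤ _ * ‖c‖
    have hs : 0 < √A := Real.sqrt_pos.2 hA
    refine max_le ?_ ?_
    · calc ‖f‖ ≤ (1 / √A) * ‖c‖ := by
            rw [one_div, inv_mul_eq_div, le_div_iff₀ hs, mul_comm]; exact h4
        _ ≤ _ := by gcongr; exact le_max_right _ _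
    · calc ‖c‖ = 1 * ‖c‖ := by ring
        _ ≤ _ := by gcongr; exact le_max_left _ _
  have hanti := AddMonoidHomClass.antilipschitz_of_bound F hb
  have hclo : IsClosed (Set.range F) := hanti.isClosed_range F.uniformContinuous
  let e := F.equivRange hanti.injective hclo
  have he : ∀ p, ((e p : _) : lp (fun _ : ℕ => ℂ) 2) = p.1.2 := fun p => rfl
  refine ⟨F.range, (ContinuousLinearMap.fst ℂ H (lp (fun _ : ℕ => ℂ) 2)).comp
    ((auxGraph ξ).subtypeL.comp (e.symm : F.range →L[ℂ] auxGraph ξ)), ?_, ?_, ?_⟩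
  · exact hclo
  · intro c n
    obtain ⟨p, rfl⟩ := e.surjective c
    simp only [ContinuousLinearMap.comp_apply, ContinuousLinearEquiv.coe_coe,
      ContinuousLinearEquiv.symm_apply_apply, he]
    exact p.2 n
  · intro f c hc
    let p : auxGraph ξ := ⟨(f, c), hc⟩
    refine ⟨⟨p, rfl⟩, ?_⟩
    have : (⟨c, ⟨p, rfl⟩⟩ : F.range) = e p := rfl
    rw [this]
    simp only [ContinuousLinearMap.comp_apply, ContinuousLinearEquiv.coe_coe,
      ContinuousLinearEquiv.symm_apply_apply]
    rfl

lemma aux_hasSum {H : Type*} [NormedAddCommGroup H] [InnerProductSpace ℂ H]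
    (ξ η : ℕ → H) (f g : H) (c d : lp (fun _ : ℕ => ℂ) 2) (hc : ∀ n, c n = ⟪ξ n, f⟫)
    (hd : ∀ n, d n = ⟪η n, g⟫) : HasSum (fun n => ⟪ξ n, f⟫ * ⟪g, η n⟫) ⟪d, c⟫ := by
  have h := lp.hasSum_inner (𝕜 := ℂ) d c
  have e : (fun n => ⟪ξ n, f⟫ * ⟪g, η n⟫) = fun n => ⟪d n, c n⟫ := by
    funext n
    rw [hc, hd, RCLike.inner_apply, inner_conj_symm]
  rw [e]
  exact h

/-- Let `ξ, η` be sequences with `dom(η)` dense, and suppose the form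
`Ω_{ξ,η}(f,g) = ⟨C_ξ f, C_η g⟩_{ℓ²}` on `dom(ξ) × dom(η)` is 0-closed, i.e. `ξ, η` are
lower semi-frames and `R(C_ξ) ∔ R(C_η)^⊥ = ℓ²`. Then the associated operator
`T = C_η*C_ξ` is boundedly invertible: `0 ∈ ρ(C_η*C_ξ)`. Here `T` is characterized by:
`f ∈ dom(T)` with `T f = h` iff `f ∈ dom(ξ)` and `Ω_{ξ,η}(f,g) = ⟨h,g⟩` for all
`g ∈ dom(η)`. -/
theorem stmt12 {H : Type*} [NormedAddCommGroup H] [InnerProductSpace ℂ H] [CompleteSpace H]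
    (ξ η : ℕ → H)
    (hηdense : Dense {g : H | Summable fun n => ‖⟪η n, g⟫‖ ^ 2})
    (hξlow : ∃ A > (0 : ℝ), ∀ f : H, (Summable fun n => ‖⟪ξ n, f⟫‖ ^ 2) →
      A * ‖f‖ ^ 2 ≤ ∑' n, ‖⟪ξ n, f⟫‖ ^ 2)
    (hηlow : ∃ A > (0 : ℝ), ∀ g : H, (Summable fun n => ‖⟪η n, g⟫‖ ^ 2) →
      A * ‖g‖ ^ 2 ≤ ∑' n, ‖⟪η n, g⟫‖ ^ 2)
    -- `R(C_ξ) ∔ R(C_η)^⊥ = ℓ²` :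
    (hdirect1 : ∀ c : lp (fun _ : ℕ => ℂ) 2,
      c ∈ {c : lp (fun _ : ℕ => ℂ) 2 | ∃ f : H, (Summable fun n => ‖⟪ξ n, f⟫‖ ^ 2) ∧
        ∀ n, c n = ⟪ξ n, f⟫} →
      c ∈ {c : lp (fun _ : ℕ => ℂ) 2 | ∀ d : lp (fun _ : ℕ => ℂ) 2,
        (∃ g : H, (Summable fun n => ‖⟪η n, g⟫‖ ^ 2) ∧ ∀ n, d n = ⟪η n, g⟫) → ⟪d, c⟫ = 0} →
      c = 0)
    (hdirect2 : ∀ c : lp (fun _ : ℕ => ℂ) 2,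
      ∃ u ∈ {c : lp (fun _ : ℕ => ℂ) 2 | ∃ f : H, (Summable fun n => ‖⟪ξ n, f⟫‖ ^ 2) ∧
          ∀ n, c n = ⟪ξ n, f⟫},
      ∃ v ∈ {c : lp (fun _ : ℕ => ℂ) 2 | ∀ d : lp (fun _ : ℕ => ℂ) 2,
          (∃ g : H, (Summable fun n => ‖⟪η n, g⟫‖ ^ 2) ∧ ∀ n, d n = ⟪η n, g⟫) → ⟪d, c⟫ = 0},
        c = u + v)
    -- the operator `T = C_η*C_ξ` associated to the form :
    (domT : Set H) (T : H → H)
    (hT1 : ∀ f ∈ domT, (Summable fun n => ‖⟪ξ n, f⟫‖ ^ 2) ∧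
      ∀ g : H, (Summable fun n => ‖⟪η n, g⟫‖ ^ 2) →
        HasSum (fun n => ⟪ξ n, f⟫ * ⟪g, η n⟫) ⟪g, T f⟫)
    (hT2 : ∀ f : H, (Summable fun n => ‖⟪ξ n, f⟫‖ ^ 2) → ∀ h : H,
      (∀ g : H, (Summable fun n => ‖⟪η n, g⟫‖ ^ 2) →
        HasSum (fun n => ⟪ξ n, f⟫ * ⟪g, η n⟫) ⟪g, h⟫) → f ∈ domT ∧ T f = h) :
    ∃ Tinv : H →L[ℂ] H, (∀ f ∈ domT, Tinv (T f) = f) ∧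
      ∀ h : H, Tinv h ∈ domT ∧ T (Tinv h) = h := by
  obtain ⟨R, K, hRc, hRK, hR⟩ := aux_main ξ hξlow
  obtain ⟨Q, L, hQc, hQL, hQ⟩ := aux_main η hηlow
  have : CompleteSpace Q := hQc.completeSpace_coe
  have hsum : ∀ (ζ : ℕ → H) (f : H) (c : lp (fun _ : ℕ => ℂ) 2), (∀ n, c n = ⟪ζ n, f⟫) →
      Summable fun n => ‖⟪ζ n, f⟫‖ ^ 2 := by
    intro ζ f c hc
    simpa only [hc] using (aux_norm_sq c).1
  have hperp : ∀ c : lp (fun _ : ℕ => ℂ) 2, c ∈ Qᗮ ↔ ∀ d : lp (fun _ : ℕ => ℂ) 2,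
        (∃ g : H, (Summable fun n => ‖⟪η n, g⟫‖ ^ 2) ∧ ∀ n, d n = ⟪η n, g⟫) → ⟪d, c⟫ = 0 := by
    intro c
    rw [Submodule.mem_orthogonal]
    constructor
    · rintro h d ⟨g, -, hd⟩
      exact h d (hQ g d hd).1
    · intro h d hd
      exact h d ⟨L ⟨d, hd⟩, hsum η _ d (hQL ⟨d, hd⟩), hQL ⟨d, hd⟩⟩
  have hdisj : ∀ c ∈ R, c ∈ Qᗮ → c = 0 := by
    intro c h1 h2
    exact hdirect1 c ⟨K ⟨c, h1⟩, hsum ξ _ c (hRK ⟨c, h1⟩), hRK ⟨c, h1⟩⟩ ((hperp c).1 h2)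
  have hcompl : IsCompl R Qᗮ := by
    constructor
    · rw [Submodule.disjoint_def]
      exact hdisj
    · rw [codisjoint_iff, eq_top_iff]
      rintro c -
      obtain ⟨u, ⟨f, -, hu⟩, v, hv, rfl⟩ := hdirect2 c
      exact Submodule.add_mem_sup (hR f u hu).1 ((hperp v).2 hv)
  have hcont : Continuous (R.projectionOnto Qᗮ hcompl) :=
    (Submodule.IsCompl.isTopCompl_iff_projectionOnto hcompl).1
      (Submodule.IsCompl.isTopCompl_of_isClosed hcompl hRc (Submodule.isClosed_orthogonal Q))
  let P : lp (fun _ : ℕ => ℂ) 2 →L[ℂ] R := ⟨R.projectionOnto Qᗮ hcompl, hcont⟩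
  have hP : ∀ c, c - (P c : lp (fun _ : ℕ => ℂ) 2) ∈ Qᗮ := by
    intro c
    exact Submodule.sub_projection_mem hcompl c
  let S : H →L[ℂ] H := K.comp (P.comp (Q.subtypeL.comp (ContinuousLinearMap.adjoint L)))
  have hS : ∀ h : H, S h ∈ domT ∧ T (S h) = h := by
    intro h
    set c0 : Q := ContinuousLinearMap.adjoint L h with hc0
    have hSc := hRK (P c0)
    refine hT2 (S h) (hsum ξ _ _ hSc) h ?_
    intro g hg
    obtain ⟨d, hd⟩ := aux_mem η g hg
    have key := aux_hasSum ξ η (S h) g _ d hSc hd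
    obtain ⟨hdQ, hLd⟩ := hQ g d hd
    have h1 : ⟪d, (P c0 : lp (fun _ : ℕ => ℂ) 2)⟫ = ⟪d, (c0 : lp (fun _ : ℕ => ℂ) 2)⟫ := by
      have := (Submodule.mem_orthogonal _ _).1 (hP c0) d hdQ
      rw [inner_sub_right, sub_eq_zero] at this
      exact this.symm
    have h2 : ⟪d, (c0 : lp (fun _ : ℕ => ℂ) 2)⟫ = ⟪g, h⟫ := by
      have := ContinuousLinearMap.adjoint_inner_right L ⟨d, hdQ⟩ h
      rw [hLd] at this
      exact this
    rw [h1, h2] at key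
    exact key
  refine ⟨S, ?_, hS⟩
  intro f hf
  obtain ⟨hfs, hfT⟩ := hT1 f hf
  obtain ⟨hgd, hgT⟩ := hS (T f)
  obtain ⟨hgs, hgT'⟩ := hT1 _ hgd
  rw [hgT] at hgT'
  obtain ⟨c, hc⟩ := aux_mem ξ f hfs
  obtain ⟨c', hc'⟩ := aux_mem ξ _ hgs
  obtain ⟨hcR, hcK⟩ := hR _ _ hc
  obtain ⟨hcR', hcK'⟩ := hR _ _ hc'
  have hz : c' - c = 0 := by
    refine hdisj _ (R.sub_mem hcR' hcR) ((hperp _).2 ?_)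
    rintro d ⟨g, hg, hd⟩
    rw [inner_sub_right, sub_eq_zero]
    rw [(aux_hasSum ξ η _ g c' d hc' hd).unique (hgT' g hg),
      (aux_hasSum ξ η _ g c d hc hd).unique (hfT g hg)]
  have hz' : c' = c := sub_eq_zero.1 hz
  subst hz'
  rw [← hcK', hcK]
end
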